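/- arXiv:2504.03000 — 11 statements merged into one kernel-verified Lean document; each statement's English description precedes it below -/
import Mathlib

section
/- Let T be a t-norm and I a fuzzy implication function. If I(1,y) ≤ y for all y ∈ [0,1] and I satisfies the monotonicity of the generalized modus ponens (MTC) with respect to T, then I satisfies T-conditionality (TC) with respect to T. In particular, if I satisfies the left neutrality principle I(1,y) = y for all y, then (MTC) with respect to T implies (TC) with respect to T. -/
open Set

/-- A t-norm on the unit interval: commutative, associative, increasing in each
variable, with neutral element 1. -/
def IsTNorm (T : ℝ → ℝ → ℝ) : Prop :=
  (∀ x ∈ Icc (0:ℝ) 1, ∀ y ∈ Icc (0:ℝ) 1, T x y ∈ Icc (0:ℝ) 1) ∧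
  (∀ x ∈ Icc (0:ℝ) 1, ∀ y ∈ Icc (0:ℝ) 1, T x y = T y x) ∧
  (∀ x ∈ Icc (0:ℝ) 1, ∀ y ∈ Icc (0:ℝ) 1, ∀ z ∈ Icc (0:ℝ) 1, T (T x y) z = T x (T y z)) ∧
  (∀ y ∈ Icc (0:ℝ) 1, ∀ x₁ ∈ Icc (0:ℝ) 1, ∀ x₂ ∈ Icc (0:ℝ) 1, x₁ ≤ x₂ → T x₁ y ≤ T x₂ y) ∧
  (∀ x ∈ Icc (0:ℝ) 1, ∀ y₁ ∈ Icc (0:ℝ) 1, ∀ y₂ ∈ Icc (0:ℝ) 1, y₁ ≤ y₂ → T x y₁ ≤ T x y₂) ∧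
  (∀ x ∈ Icc (0:ℝ) 1, T x 1 = x)

/-- A fuzzy implication function on the unit interval: decreasing in the first
variable, increasing in the second, with I(0,0)=I(1,1)=1 and I(1,0)=0. -/
def IsFuzzyImplication (I : ℝ → ℝ → ℝ) : Prop :=
  (∀ x ∈ Icc (0:ℝ) 1, ∀ y ∈ Icc (0:ℝ) 1, I x y ∈ Icc (0:ℝ) 1) ∧
  (∀ y ∈ Icc (0:ℝ) 1, ∀ x₁ ∈ Icc (0:ℝ) 1, ∀ x₂ ∈ Icc (0:ℝ) 1, x₁ ≤ x₂ → I x₂ y ≤ I x₁ y) ∧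
  (∀ x ∈ Icc (0:ℝ) 1, ∀ y₁ ∈ Icc (0:ℝ) 1, ∀ y₂ ∈ Icc (0:ℝ) 1, y₁ ≤ y₂ → I x y₁ ≤ I x y₂) ∧
  I 0 0 = 1 ∧ I 1 1 = 1 ∧ I 1 0 = 0

/-- T-conditionality: T(x, I(x,y)) ≤ y for all x, y ∈ [0,1]. -/
def TCond (T I : ℝ → ℝ → ℝ) : Prop :=
  ∀ x ∈ Icc (0:ℝ) 1, ∀ y ∈ Icc (0:ℝ) 1, T x (I x y) ≤ y

/-- Monotonicity of the generalized modus ponens: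
T(x̃, I(x̃,y)) ≤ T(x, I(x,y)) whenever x̃ ≤ x. -/
def MTCond (T I : ℝ → ℝ → ℝ) : Prop :=
  ∀ x' ∈ Icc (0:ℝ) 1, ∀ x ∈ Icc (0:ℝ) 1, ∀ y ∈ Icc (0:ℝ) 1, x' ≤ x →
    T x' (I x' y) ≤ T x (I x y)

/-- If I(1,y) ≤ y on [0,1] and (MTC) holds w.r.t. T, then (TC) holds
w.r.t. T. In particular, the left neutrality principle together with (MTC) implies (TC). -/
theorem stmt_0 (T I : ℝ → ℝ → ℝ) (hT : IsTNorm T) (hI : IsFuzzyImplication I) :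
    ((∀ y ∈ Icc (0:ℝ) 1, I 1 y ≤ y) → MTCond T I → TCond T I) ∧
    ((∀ y ∈ Icc (0:ℝ) 1, I 1 y = y) → MTCond T I → TCond T I) := by
  have tcond_of_le (h : ∀ y ∈ Icc (0:ℝ) 1, I 1 y ≤ y) (hM : MTCond T I) : TCond T I := by
    obtain ⟨-, hcomm, -, -, -, hone⟩ := hT
    intro x hx y hy
    have h1 : (1:ℝ) ∈ Icc (0:ℝ) 1 := ⟨zero_le_one, le_rfl⟩
    have hI1 := hI.1 1 h1 y hy
    calc T x (I x y) ≤ T 1 (I 1 y) := hM x hx 1 h1 y hy hx.2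
      _ = I 1 y := by rw [hcomm 1 h1 _ hI1, hone _ hI1]
      _ ≤ y := h y hy
  exact ⟨tcond_of_le, fun h => tcond_of_le fun y hy => (h y hy).le⟩
end

section
/- Let T be a t-norm and I a fuzzy implication function satisfying the ordering property (OP). Then I satisfies the monotonicity of the generalized modus ponens (MTC) with respect to T if and only if, for every y ∈ [0,1), the function f_y : [y,1] → [0,1] defined by f_y(x) = T(x, I(x,y)) is increasing. -/
open Set

/-- Under the ordering property, `T x (I x y) = x` whenever `x ≤ y`. -/
theorem tnorm_impl_eq_left_of_le {T I : ℝ → ℝ → ℝ} (hT : IsTNorm T)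
    (hOP : ∀ x ∈ Icc (0:ℝ) 1, ∀ y ∈ Icc (0:ℝ) 1, (I x y = 1 ↔ x ≤ y))
    {x y : ℝ} (hx : x ∈ Icc (0:ℝ) 1) (hy : y ∈ Icc (0:ℝ) 1) (hxy : x ≤ y) :
    T x (I x y) = x := by
  obtain ⟨-, -, -, -, -, hone⟩ := hT
  rw [(hOP x hx y hy).2 hxy, hone x hx]

/-- if I satisfies the ordering property (OP), then I satisfies (MTC)
w.r.t. T iff for every y ∈ [0,1) the function f_y(x) = T(x, I(x,y)) is increasing on [y,1]. -/
theorem stmt_1 (T I : ℝ → ℝ → ℝ) (hT : IsTNorm T) (hI : IsFuzzyImplication I)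
    (hOP : ∀ x ∈ Icc (0:ℝ) 1, ∀ y ∈ Icc (0:ℝ) 1, (I x y = 1 ↔ x ≤ y)) :
    MTCond T I ↔
      ∀ y ∈ Ico (0:ℝ) 1, ∀ x₁ ∈ Icc y 1, ∀ x₂ ∈ Icc y 1, x₁ ≤ x₂ →
        T x₁ (I x₁ y) ≤ T x₂ (I x₂ y) := by
  constructor
  · intro h y hy x₁ hx₁ x₂ hx₂ hle
    exact h x₁ ⟨hy.1.trans hx₁.1, hx₁.2⟩ x₂ ⟨hy.1.trans hx₂.1, hx₂.2⟩ y ⟨hy.1, hy.2.le⟩ hle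
  · intro h x' hx' x hx y hy hle
    rcases le_total x y with hxy | hyx
    · rw [tnorm_impl_eq_left_of_le hT hOP hx' hy (hle.trans hxy),
        tnorm_impl_eq_left_of_le hT hOP hx hy hxy]
      exact hle
    · rcases hy.2.eq_or_lt with rfl | hy1
      · rw [tnorm_impl_eq_left_of_le hT hOP hx' hy hx'.2,
          tnorm_impl_eq_left_of_le hT hOP hx hy hx.2]
        exact hle
      · rcases le_total x' y with hx'y | hyx'
        · calc T x' (I x' y) = x' := tnorm_impl_eq_left_of_le hT hOP hx' hy hx'y
            _ ≤ y := hx'y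
            _ = T y (I y y) := (tnorm_impl_eq_left_of_le hT hOP hy hy le_rfl).symm
            _ ≤ T x (I x y) := h y ⟨hy.1, hy1⟩ y ⟨le_rfl, hy.2⟩ x ⟨hyx, hx.2⟩ hyx
        · exact h y ⟨hy.1, hy1⟩ x' ⟨hyx', hx'.2⟩ x ⟨hyx, hx.2⟩ hle
end

section
/- Let t : [0,1] → [0,∞] be a continuous strictly decreasing function with t(1) = 0 (values in the extended nonnegative reals, with t(0) possibly equal to +∞). Define the continuous Archimedean t-norm T(x,y) = t⁻¹(min(t(x) + t(y), t(0))) and its R-implication I_T(x,y) = 1 if x ≤ y and I_T(x,y) = t⁻¹(t(y) − t(x)) if x > y. Then T(x, I_T(x,y)) = min(x,y) for all x, y ∈ [0,1]; in particular, I_T satisfies both T-conditionality (TC) and the monotonicity of the generalized modus ponens (MTC) with respect to T. -/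
open Set

/-- for a continuous Archimedean t-norm T with additive generator t
(a continuous, strictly decreasing function t : [0,1] → [0,∞] with t(1) = 0, with
inverse t⁻¹ from its range [0, t(0)] onto [0,1]), given
T(x,y) = t⁻¹(min(t(x)+t(y), t(0))) and the R-implication
I_T(x,y) = 1 if x ≤ y and t⁻¹(t(y) − t(x)) otherwise, one has
T(x, I_T(x,y)) = min(x,y) on [0,1]²; in particular (TC) and (MTC) hold. -/
theorem stmt_3 (t : ℝ → ENNReal) (tinv : ENNReal → ℝ)
    (ht_cont : ContinuousOn t (Icc (0:ℝ) 1))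
    (ht_anti : StrictAntiOn t (Icc (0:ℝ) 1))
    (ht1 : t 1 = 0)
    (htinv_mem : ∀ z, z ≤ t 0 → tinv z ∈ Icc (0:ℝ) 1)
    (h_left : ∀ x ∈ Icc (0:ℝ) 1, tinv (t x) = x)
    (h_right : ∀ z, z ≤ t 0 → t (tinv z) = z)
    (T It : ℝ → ℝ → ℝ)
    (hT : ∀ x y, T x y = tinv (min (t x + t y) (t 0)))
    (hIt : ∀ x y, It x y = if x ≤ y then 1 else tinv (t y - t x)) :
    (∀ x ∈ Icc (0:ℝ) 1, ∀ y ∈ Icc (0:ℝ) 1, T x (It x y) = min x y) ∧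
    TCond T It ∧ MTCond T It := by
  have anti {x y : ℝ} (hx : x ∈ Icc (0:ℝ) 1) (hy : y ∈ Icc (0:ℝ) 1) (hxy : x ≤ y) :
      t y ≤ t x := ht_anti.antitoneOn hx hy hxy
  have le_zero {x : ℝ} (hx : x ∈ Icc (0:ℝ) 1) : t x ≤ t 0 :=
    anti (left_mem_Icc.2 zero_le_one) hx hx.1
  have key : ∀ x ∈ Icc (0:ℝ) 1, ∀ y ∈ Icc (0:ℝ) 1, T x (It x y) = min x y := by
    intro x hx y hy
    rw [hT, hIt]
    split_ifs with hxy
    · rw [ht1, add_zero, min_eq_left (le_zero hx), h_left x hx, min_eq_left hxy]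
    · have hyx : y ≤ x := (not_le.1 hxy).le
      rw [h_right _ (tsub_le_self.trans (le_zero hy)), add_tsub_cancel_of_le (anti hy hx hyx),
        min_eq_left (le_zero hy), h_left y hy, min_eq_right hyx]
  refine ⟨key, fun x hx y hy => ?_, fun x' hx' x hx y hy hxx' => ?_⟩
  · rw [key x hx y hy]
    exact min_le_right x y
  · rw [key x' hx' y hy, key x hx y hy]
    exact min_le_min_right y hxx'
end

section
/- Let C be a bivariate copula and define I_C : [0,1]² → [0,1] by I_C(x,y) = 1 if x = 0 and I_C(x,y) = C(x,y)/x if x > 0. Then I_C is a fuzzy implication function if and only if C(x₁,y)·x₂ ≥ C(x₂,y)·x₁ for all x₁, x₂, y ∈ [0,1] with x₁ ≤ x₂. -/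
open Set

/-- A bivariate copula on the unit square. -/
def IsCopula (C : ℝ → ℝ → ℝ) : Prop :=
  (∀ x ∈ Icc (0:ℝ) 1, ∀ y ∈ Icc (0:ℝ) 1, C x y ∈ Icc (0:ℝ) 1) ∧
  (∀ x ∈ Icc (0:ℝ) 1, C x 0 = 0) ∧
  (∀ y ∈ Icc (0:ℝ) 1, C 0 y = 0) ∧
  (∀ x ∈ Icc (0:ℝ) 1, C x 1 = x) ∧
  (∀ y ∈ Icc (0:ℝ) 1, C 1 y = y) ∧
  (∀ x₁ ∈ Icc (0:ℝ) 1, ∀ x₂ ∈ Icc (0:ℝ) 1, ∀ y₁ ∈ Icc (0:ℝ) 1, ∀ y₂ ∈ Icc (0:ℝ) 1,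
    x₁ ≤ x₂ → y₁ ≤ y₂ → 0 ≤ C x₂ y₂ - C x₂ y₁ - C x₁ y₂ + C x₁ y₁)

/-- The probabilistic implication associated to a copula C:
I_C(x,y) = 1 if x = 0 and C(x,y)/x if x > 0. -/
noncomputable def IC (C : ℝ → ℝ → ℝ) (x y : ℝ) : ℝ := if x = 0 then 1 else C x y / x

namespace IsCopula

variable {C : ℝ → ℝ → ℝ}

/-- A copula is increasing in its second variable. -/
theorem mono_right (hC : IsCopula C) {x y₁ y₂ : ℝ} (hx : x ∈ Icc (0:ℝ) 1)
    (hy₁ : y₁ ∈ Icc (0:ℝ) 1) (hy₂ : y₂ ∈ Icc (0:ℝ) 1) (h : y₁ ≤ y₂) : C x y₁ ≤ C x y₂ := by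
  obtain ⟨-, -, h0, -, -, hinc⟩ := hC
  have := hinc 0 (by simp) x hx y₁ hy₁ y₂ hy₂ hx.1 h
  rw [h0 y₁ hy₁, h0 y₂ hy₂] at this
  linarith

/-- A copula is bounded above by its first variable. -/
theorem le_left (hC : IsCopula C) {x y : ℝ} (hx : x ∈ Icc (0:ℝ) 1) (hy : y ∈ Icc (0:ℝ) 1) :
    C x y ≤ x :=
  (hC.mono_right hx hy (by simp) hy.2).trans_eq (hC.2.2.2.1 x hx)

/-- The function `IC C` takes values in the unit interval. -/
theorem IC_mem_Icc (hC : IsCopula C) {x y : ℝ} (hx : x ∈ Icc (0:ℝ) 1) (hy : y ∈ Icc (0:ℝ) 1) :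
    IC C x y ∈ Icc (0:ℝ) 1 := by
  unfold IC
  split_ifs
  · simp
  · exact ⟨div_nonneg (hC.1 x hx y hy).1 hx.1, div_le_one_of_le₀ (hC.le_left hx hy) hx.1⟩

end IsCopula

/-- I_C is a fuzzy implication function iff
C(x₁,y)·x₂ ≥ C(x₂,y)·x₁ for all x₁ ≤ x₂ and y in [0,1]. -/
theorem stmt_4 (C : ℝ → ℝ → ℝ) (hC : IsCopula C) :
    IsFuzzyImplication (IC C) ↔
      ∀ x₁ ∈ Icc (0:ℝ) 1, ∀ x₂ ∈ Icc (0:ℝ) 1, ∀ y ∈ Icc (0:ℝ) 1, x₁ ≤ x₂ →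
        C x₂ y * x₁ ≤ C x₁ y * x₂ := by
  constructor
  · rintro ⟨-, hanti, -⟩ x₁ hx₁ x₂ hx₂ y hy h
    rcases hx₁.1.eq_or_lt with rfl | hpos
    · simp [hC.2.2.1 y hy]
    · have hpos₂ := hpos.trans_le h
      have := hanti y hy x₁ hx₁ x₂ hx₂ h
      rwa [IC, IC, if_neg hpos.ne', if_neg hpos₂.ne', div_le_div_iff₀ hpos₂ hpos] at this
  · intro H
    refine ⟨fun x hx y hy => hC.IC_mem_Icc hx hy, ?_, ?_, by simp [IC], ?_, ?_⟩
    · intro y hy x₁ hx₁ x₂ hx₂ h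
      rcases hx₁.1.eq_or_lt with rfl | hpos
      · simpa [IC] using (hC.IC_mem_Icc hx₂ hy).2
      · have hpos₂ := hpos.trans_le h
        rw [IC, IC, if_neg hpos.ne', if_neg hpos₂.ne', div_le_div_iff₀ hpos₂ hpos]
        exact H x₁ hx₁ x₂ hx₂ y hy h
    · intro x hx y₁ hy₁ y₂ hy₂ h
      unfold IC
      split_ifs
      · exact le_rfl
      · exact div_le_div_of_nonneg_right (hC.mono_right hx hy₁ hy₂ h) hx.1
    · simp [IC, hC.2.2.2.1 1 (by simp)]
    · simp [IC, hC.2.1 1 (by simp)]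
end

section
/- Let C be a bivariate copula satisfying C(x₁,y)·x₂ ≥ C(x₂,y)·x₁ for all x₁ ≤ x₂ and y ∈ [0,1], and let I_C be the associated probabilistic implication, I_C(x,y) = 1 if x = 0 and I_C(x,y) = C(x,y)/x if x > 0. Then I_C satisfies T-conditionality (TC) with respect to the product t-norm T_P(x,y) = x·y; that is, x·I_C(x,y) ≤ y for all x, y ∈ [0,1]. -/
open Set

/-- A copula is bounded above by its second argument. -/
theorem IsCopula.le_right {C : ℝ → ℝ → ℝ} (hC : IsCopula C) {x y : ℝ}
    (hx : x ∈ Icc (0:ℝ) 1) (hy : y ∈ Icc (0:ℝ) 1) : C x y ≤ y := by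
  obtain ⟨-, hx0, -, -, h1y, hinc⟩ := hC
  have h0 : (0:ℝ) ∈ Icc (0:ℝ) 1 := by simp
  have h1 : (1:ℝ) ∈ Icc (0:ℝ) 1 := by simp
  have h := hinc x hx 1 h1 0 h0 y hy hx.2 hy.1
  rw [h1y y hy, hx0 1 h1, hx0 x hx] at h
  linarith

/-- a probabilistic implication I_C satisfies (TC) with respect to the
product t-norm, i.e. x·I_C(x,y) ≤ y for all x, y ∈ [0,1]. -/
theorem stmt_5 (C : ℝ → ℝ → ℝ) (hC : IsCopula C)
    (hcond : ∀ x₁ ∈ Icc (0:ℝ) 1, ∀ x₂ ∈ Icc (0:ℝ) 1, ∀ y ∈ Icc (0:ℝ) 1, x₁ ≤ x₂ →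
      C x₂ y * x₁ ≤ C x₁ y * x₂) :
    ∀ x ∈ Icc (0:ℝ) 1, ∀ y ∈ Icc (0:ℝ) 1, x * IC C x y ≤ y := by
  intro x hx y hy
  by_cases h : x = 0
  · simpa [h] using hy.1
  · rw [IC, if_neg h, mul_div_cancel₀ _ h]
    exact hC.le_right hx hy
end

section
/- Let C be a bivariate copula satisfying C(x₁,y)·x₂ ≥ C(x₂,y)·x₁ for all x₁ ≤ x₂ and y ∈ [0,1], and let I_C be the associated probabilistic implication, I_C(x,y) = 1 if x = 0 and I_C(x,y) = C(x,y)/x if x > 0. Then x·I_C(x,y) = C(x,y) for all x ∈ (0,1] and y ∈ [0,1], and I_C satisfies the monotonicity of the generalized modus ponens (MTC) with respect to the product t-norm T_P(x,y) = x·y; that is, x̃·I_C(x̃,y) ≤ x·I_C(x,y) whenever 0 ≤ x̃ ≤ x ≤ 1 and y ∈ [0,1]. -/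
open Set

/-- Multiplying the probabilistic implication by a nonzero antecedent recovers the copula. -/
theorem mul_IC_of_ne_zero (C : ℝ → ℝ → ℝ) {x : ℝ} (hx : x ≠ 0) (y : ℝ) :
    x * IC C x y = C x y := by
  rw [IC, if_neg hx, mul_div_cancel₀ _ hx]

/-- A copula is increasing in its first variable. -/
theorem IsCopula.mono_left {C : ℝ → ℝ → ℝ} (hC : IsCopula C) {x₁ x₂ y : ℝ}
    (hx₁ : x₁ ∈ Icc (0:ℝ) 1) (hx₂ : x₂ ∈ Icc (0:ℝ) 1) (hy : y ∈ Icc (0:ℝ) 1)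
    (h : x₁ ≤ x₂) : C x₁ y ≤ C x₂ y := by
  obtain ⟨-, hzero, -, -, -, hinc⟩ := hC
  have hrect := hinc x₁ hx₁ x₂ hx₂ 0 (by simp) y hy h hy.1
  rw [hzero x₁ hx₁, hzero x₂ hx₂] at hrect
  linarith

/-- for a probabilistic implication I_C one has x·I_C(x,y) = C(x,y)
for x ∈ (0,1] and y ∈ [0,1], and I_C satisfies (MTC) with respect to the product
t-norm: x̃·I_C(x̃,y) ≤ x·I_C(x,y) whenever 0 ≤ x̃ ≤ x ≤ 1 and y ∈ [0,1]. -/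
theorem stmt_6 (C : ℝ → ℝ → ℝ) (hC : IsCopula C)
    (hcond : ∀ x₁ ∈ Icc (0:ℝ) 1, ∀ x₂ ∈ Icc (0:ℝ) 1, ∀ y ∈ Icc (0:ℝ) 1, x₁ ≤ x₂ →
      C x₂ y * x₁ ≤ C x₁ y * x₂) :
    (∀ x ∈ Ioc (0:ℝ) 1, ∀ y ∈ Icc (0:ℝ) 1, x * IC C x y = C x y) ∧
    (∀ x' x y : ℝ, 0 ≤ x' → x' ≤ x → x ≤ 1 → y ∈ Icc (0:ℝ) 1 →
      x' * IC C x' y ≤ x * IC C x y) := by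
  have hmul : ∀ x ∈ Icc (0:ℝ) 1, ∀ y ∈ Icc (0:ℝ) 1, x * IC C x y = C x y := by
    intro x _ y hy
    rcases eq_or_ne x 0 with rfl | hx
    · rw [zero_mul, hC.2.2.1 y hy]
    · exact mul_IC_of_ne_zero C hx y
  refine ⟨fun x hx => hmul x (Ioc_subset_Icc_self hx), fun x' x y h0 hle h1 hy => ?_⟩
  have hx' : x' ∈ Icc (0:ℝ) 1 := ⟨h0, hle.trans h1⟩
  have hx : x ∈ Icc (0:ℝ) 1 := ⟨h0.trans hle, h1⟩
  rw [hmul x' hx' y hy, hmul x hx y hy]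
  exact hC.mono_left hx' hx hy hle
end

section
/- Let k : [0,1] → [0,1] be a k-generator with k(0) = 0 and k(x) ≤ x for all x ∈ [0,1]. Define the k-generated implication I_k(x,y) = k⁻¹(min(k(y)/x, 1)) for x > 0 and I_k(0,y) = 1, and the t-norm T_k(x,y) = k⁻¹(k(x)·k(y)) generated by k as multiplicative generator. Then for every t-norm T with T(x,y) ≤ T_k(x,y) for all x, y ∈ [0,1], the implication I_k satisfies T-conditionality (TC) with respect to T, i.e., T(x, I_k(x,y)) ≤ y for all x, y ∈ [0,1]. -/
open Set

/-- The t-norm generated by the multiplicative generator k: T_k(x,y) = k⁻¹(k(x)·k(y)). -/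
noncomputable def Tk (k kinv : ℝ → ℝ) (x y : ℝ) : ℝ := kinv (k x * k y)

/-- The k-generated implication: I_k(x,y) = k⁻¹(min(k(y)/x, 1)) for x > 0, and 1 for x = 0. -/
noncomputable def Ik (k kinv : ℝ → ℝ) (x y : ℝ) : ℝ :=
  if x = 0 then 1 else kinv (min (k y / x) 1)

/-- for a k-generator k (strictly increasing, continuous, k(1)=1) with
k(0)=0 and k ≤ id, the k-generated implication I_k satisfies (TC) with respect to
every t-norm T weaker than T_k. -/
theorem stmt_7 (k kinv : ℝ → ℝ)
    (hk_mono : StrictMonoOn k (Icc (0:ℝ) 1))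
    (hk_cont : ContinuousOn k (Icc (0:ℝ) 1))
    (hk1 : k 1 = 1) (hk0 : k 0 = 0)
    (hk_le : ∀ x ∈ Icc (0:ℝ) 1, k x ≤ x)
    (hinv_left : ∀ x ∈ Icc (0:ℝ) 1, kinv (k x) = x)
    (hinv_right : ∀ z ∈ Icc (0:ℝ) 1, k (kinv z) = z)
    (T : ℝ → ℝ → ℝ) (hT : IsTNorm T)
    (hT_weaker : ∀ x ∈ Icc (0:ℝ) 1, ∀ y ∈ Icc (0:ℝ) 1, T x y ≤ Tk k kinv x y) :
    TCond T (Ik k kinv) := by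
  have hsurj : ∀ z ∈ Icc (0:ℝ) 1, ∃ w ∈ Icc (0:ℝ) 1, k w = z := by
    intro z hz
    have h := intermediate_value_Icc zero_le_one hk_cont
    rw [hk0, hk1] at h
    exact h hz
  have hk_nonneg : ∀ x ∈ Icc (0:ℝ) 1, 0 ≤ k x := fun x hx =>
    hk0 ▸ hk_mono.monotoneOn (left_mem_Icc.2 zero_le_one) hx hx.1
  intro x hx y hy
  rcases hx.1.eq_or_lt with rfl | hx0
  · simpa [Ik, hT.2.2.2.2.2 0 hx] using hy.1
  obtain ⟨w, hw, hkw⟩ := hsurj (min (k y / x) 1)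
    ⟨le_min (div_nonneg (hk_nonneg y hy) hx0.le) zero_le_one, min_le_right _ _⟩
  have hI : Ik k kinv x y = w := by
    rw [Ik, if_neg hx0.ne', ← hkw, hinv_left w hw]
  have hle : k x * k w ≤ k y := calc
    k x * k w ≤ x * (k y / x) :=
      mul_le_mul (hk_le x hx) (hkw ▸ min_le_left _ _) (hk_nonneg w hw) hx0.le
    _ = k y := mul_div_cancel₀ _ hx0.ne'
  obtain ⟨v, hv, hkv⟩ := hsurj (k x * k w)
    ⟨mul_nonneg (hk_nonneg x hx) (hk_nonneg w hw),
      hle.trans ((hk_le y hy).trans hy.2)⟩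
  calc T x (Ik k kinv x y) = T x w := by rw [hI]
    _ ≤ Tk k kinv x w := hT_weaker x hx w hw
    _ = v := by rw [Tk, ← hkv, hinv_left v hv]
    _ ≤ y := (hk_mono.le_iff_le hv hy).1 (hkv ▸ hle)
end

section
/- Let k : [0,1] → [0,1] be a k-generator with k(0) = 0 such that k(x̃)·x ≤ k(x)·x̃ for all 0 ≤ x̃ ≤ x ≤ 1. Define the k-generated implication I_k(x,y) = k⁻¹(min(k(y)/x, 1)) for x > 0 and I_k(0,y) = 1, and the t-norm T_k(x,y) = k⁻¹(k(x)·k(y)). Then T_k(x, I_k(x,y)) = k⁻¹(k(x)·min(k(y)/x, 1)) for all x ∈ (0,1] and y ∈ [0,1], T_k(0, I_k(0,y)) = 0, and I_k satisfies the monotonicity of the generalized modus ponens (MTC) with respect to T_k. -/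
open Set

/-- An inverse of an increasing continuous bijection of the unit interval is increasing. -/
theorem monotoneOn_kinv {k kinv : ℝ → ℝ} (hk_mono : StrictMonoOn k (Icc (0:ℝ) 1))
    (hk_surj : SurjOn k (Icc (0:ℝ) 1) (Icc (0:ℝ) 1))
    (hinv_left : ∀ x ∈ Icc (0:ℝ) 1, kinv (k x) = x) :
    MonotoneOn kinv (Icc (0:ℝ) 1) := by
  intro a ha b hb hab
  obtain ⟨u, hu, rfl⟩ := hk_surj ha
  obtain ⟨v, hv, rfl⟩ := hk_surj hb
  rw [hinv_left u hu, hinv_left v hv]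
  exact (hk_mono.le_iff_le hu hv).1 hab

/-- for a k-generator k with k(0)=0 satisfying k(x̃)·x ≤ k(x)·x̃ for
0 ≤ x̃ ≤ x ≤ 1, one has T_k(x, I_k(x,y)) = k⁻¹(k(x)·min(k(y)/x, 1)) for x ∈ (0,1],
T_k(0, I_k(0,y)) = 0, and I_k satisfies (MTC) with respect to T_k. -/
theorem stmt_8 (k kinv : ℝ → ℝ)
    (hk_mono : StrictMonoOn k (Icc (0:ℝ) 1))
    (hk_cont : ContinuousOn k (Icc (0:ℝ) 1))
    (hk1 : k 1 = 1) (hk0 : k 0 = 0)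
    (hinv_left : ∀ x ∈ Icc (0:ℝ) 1, kinv (k x) = x)
    (hinv_right : ∀ z ∈ Icc (0:ℝ) 1, k (kinv z) = z)
    (hcond : ∀ x' ∈ Icc (0:ℝ) 1, ∀ x ∈ Icc (0:ℝ) 1, x' ≤ x → k x' * x ≤ k x * x') :
    (∀ x ∈ Ioc (0:ℝ) 1, ∀ y ∈ Icc (0:ℝ) 1,
      Tk k kinv x (Ik k kinv x y) = kinv (k x * min (k y / x) 1)) ∧
    (∀ y ∈ Icc (0:ℝ) 1, Tk k kinv 0 (Ik k kinv 0 y) = 0) ∧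
    MTCond (Tk k kinv) (Ik k kinv) := by
  have hsurj : SurjOn k (Icc (0:ℝ) 1) (Icc (0:ℝ) 1) := by
    have h := intermediate_value_Icc zero_le_one hk_cont
    rwa [hk0, hk1] at h
  have hk_mem : ∀ x ∈ Icc (0:ℝ) 1, k x ∈ Icc (0:ℝ) 1 := fun x hx =>
    ⟨hk0 ▸ hk_mono.monotoneOn (left_mem_Icc.2 zero_le_one) hx hx.1,
      hk1 ▸ hk_mono.monotoneOn hx (right_mem_Icc.2 zero_le_one) hx.2⟩
  have hmin : ∀ x ∈ Ioc (0:ℝ) 1, ∀ y ∈ Icc (0:ℝ) 1, min (k y / x) 1 ∈ Icc (0:ℝ) 1 :=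
    fun x hx y hy =>
      ⟨le_min (div_nonneg (hk_mem y hy).1 hx.1.le) zero_le_one, min_le_right _ _⟩
  have hprod : ∀ x ∈ Ioc (0:ℝ) 1, ∀ y ∈ Icc (0:ℝ) 1,
      k x * min (k y / x) 1 ∈ Icc (0:ℝ) 1 := fun x hx y hy =>
    unitInterval.mul_mem (hk_mem x (Ioc_subset_Icc_self hx)) (hmin x hx y hy)
  have hpos : ∀ x ∈ Ioc (0:ℝ) 1, ∀ y ∈ Icc (0:ℝ) 1,
      Tk k kinv x (Ik k kinv x y) = kinv (k x * min (k y / x) 1) := by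
    intro x hx y hy
    rw [Tk, Ik, if_neg hx.1.ne', hinv_right _ (hmin x hx y hy)]
  have hkinv0 : kinv 0 = 0 := by
    simpa [hk0] using hinv_left 0 (left_mem_Icc.2 zero_le_one)
  have hzero : ∀ y ∈ Icc (0:ℝ) 1, Tk k kinv 0 (Ik k kinv 0 y) = 0 := by
    intro y _
    rw [Tk, hk0, zero_mul, hkinv0]
  have hkinv := monotoneOn_kinv hk_mono hsurj hinv_left
  refine ⟨hpos, hzero, fun x' hx' x hx y hy hle => ?_⟩
  rcases hx'.1.eq_or_lt with rfl | hx'pos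
  · rcases hx.1.eq_or_lt with rfl | hxpos
    · exact le_rfl
    · have hxI : x ∈ Ioc (0:ℝ) 1 := ⟨hxpos, hx.2⟩
      rw [hzero y hy, hpos x hxI y hy, ← hkinv0]
      exact hkinv (left_mem_Icc.2 zero_le_one) (hprod x hxI y hy) (hprod x hxI y hy).1
  · have hx'I : x' ∈ Ioc (0:ℝ) 1 := ⟨hx'pos, hx'.2⟩
    have hxpos : 0 < x := hx'pos.trans_le hle
    have hxI : x ∈ Ioc (0:ℝ) 1 := ⟨hxpos, hx.2⟩
    rw [hpos x' hx'I y hy, hpos x hxI y hy]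
    refine hkinv (hprod x' hx'I y hy) (hprod x hxI y hy) ?_
    rw [mul_min_of_nonneg _ _ (hk_mem x' hx').1, mul_min_of_nonneg _ _ (hk_mem x hx).1]
    have hdiv : k x' / x' ≤ k x / x := (div_le_div_iff₀ hx'pos hxpos).2 (hcond x' hx' x hx hle)
    refine min_le_min ?_ ?_
    · rw [← mul_div_assoc, ← mul_div_assoc, mul_div_right_comm, mul_div_right_comm]
      exact mul_le_mul_of_nonneg_right hdiv (hk_mem y hy).1
    · simpa using hk_mono.monotoneOn hx' hx hle
end

section
/- For every λ < 0, the Schweizer–Sklar k-generator k(x) = e^{(x^λ − 1)/λ} satisfies k(x̃)·x ≤ k(x)·x̃ for all 0 < x̃ ≤ x ≤ 1; equivalently, the function x ↦ e^{(x^λ − 1)/λ}/x is increasing on (0,1]. -/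
open Set Real

/-- For `lam < 0`, the function `x ↦ (x ^ lam - 1) / lam - log x` is increasing on `(0, 1]`. -/
lemma rpow_sub_one_div_add_log_le {lam x y : ℝ} (hlam : lam < 0) (hx : 0 < x) (hxy : x ≤ y)
    (hy : y ≤ 1) :
    (x ^ lam - 1) / lam + Real.log y ≤ (y ^ lam - 1) / lam + Real.log x := by
  have hy0 : 0 < y := hx.trans_le hxy
  have hlog : Real.log x ≤ Real.log y := Real.log_le_log hx hxy
  have hone : 1 ≤ y ^ lam := Real.one_le_rpow_of_pos_of_le_one_of_nonpos hy0 hy hlam.le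
  have hmul : x ^ lam = y ^ lam * Real.exp (lam * (Real.log x - Real.log y)) := by
    rw [Real.rpow_def_of_pos hx, Real.rpow_def_of_pos hy0, ← Real.exp_add]
    ring_nf
  have hexp := Real.add_one_le_exp (lam * (Real.log x - Real.log y))
  have hnonneg : 0 ≤ lam * (Real.log x - Real.log y) :=
    mul_nonneg_of_nonpos_of_nonpos hlam.le (sub_nonpos.2 hlog)
  have hdiff : lam * (Real.log x - Real.log y) ≤ x ^ lam - y ^ lam := by
    rw [hmul]
    nlinarith
  have hdiv : (x ^ lam - y ^ lam) / lam ≤ Real.log x - Real.log y := by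
    rw [div_le_iff_of_neg hlam]
    linarith
  have hsplit : (x ^ lam - y ^ lam) / lam = (x ^ lam - 1) / lam - (y ^ lam - 1) / lam := by
    ring
  linarith

/-- for λ < 0, the Schweizer–Sklar k-generator k(x) = exp((x^λ − 1)/λ)
satisfies k(x̃)·x ≤ k(x)·x̃ for all 0 < x̃ ≤ x ≤ 1; equivalently, x ↦ k(x)/x is
increasing on (0,1]. -/
theorem stmt_9 (lam : ℝ) (hlam : lam < 0) :
    (∀ x' x : ℝ, 0 < x' → x' ≤ x → x ≤ 1 →
      Real.exp ((x' ^ lam - 1) / lam) * x ≤ Real.exp ((x ^ lam - 1) / lam) * x') ∧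
    MonotoneOn (fun x : ℝ => Real.exp ((x ^ lam - 1) / lam) / x) (Ioc (0:ℝ) 1) := by
  have key : ∀ x' x : ℝ, 0 < x' → x' ≤ x → x ≤ 1 →
      Real.exp ((x' ^ lam - 1) / lam) * x ≤ Real.exp ((x ^ lam - 1) / lam) * x' := by
    intro x' x hx' hle hx
    have h := Real.exp_le_exp.2 (rpow_sub_one_div_add_log_le hlam hx' hle hx)
    rwa [Real.exp_add, Real.exp_add, Real.exp_log hx', Real.exp_log (hx'.trans_le hle)] at h
  refine ⟨key, fun a ha b hb hab => ?_⟩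
  exact (div_le_div_iff₀ ha.1 hb.1).2 (key a b ha.1 hab hb.2)
end

section
/- Define I_Y : [0,1]² → [0,1] by I_Y(x,y) = 1 if x = 0 or y = 1, and I_Y(x,y) = y otherwise. Then I_Y is a fuzzy implication function, and for every t-norm T one has T(x, I_Y(x,y)) = T(x,y) for all x, y ∈ [0,1]; consequently, I_Y satisfies both T-conditionality (TC) and the monotonicity of the generalized modus ponens (MTC) with respect to every t-norm T. -/
open Set

/-- I_Y(x,y) = 1 if x = 0 or y = 1, and y otherwise. -/
noncomputable def IY (x y : ℝ) : ℝ := if x = 0 ∨ y = 1 then 1 else y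

theorem isFuzzyImplication_IY : IsFuzzyImplication IY := by
  refine ⟨?_, ?_, ?_, by simp [IY], by simp [IY], by simp [IY]⟩
  · intro x _ y hy
    unfold IY
    split_ifs
    · simp
    · exact hy
  · rintro y ⟨_, hy⟩ x₁ ⟨hx₁, _⟩ x₂ _ h
    unfold IY
    grind
  · rintro x _ y₁ ⟨_, hy₁⟩ y₂ ⟨_, hy₂⟩ h
    unfold IY
    grind

theorem IsTNorm.apply_le_right {T : ℝ → ℝ → ℝ} (hT : IsTNorm T) {x y : ℝ}
    (hx : x ∈ Icc (0 : ℝ) 1) (hy : y ∈ Icc (0 : ℝ) 1) : T x y ≤ y := by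
  obtain ⟨_, comm, _, _, mono, one⟩ := hT
  calc T x y = T y x := comm x hx y hy
    _ ≤ T y 1 := mono y hy x hx 1 (by simp) hx.2
    _ = y := one y hy

theorem IsTNorm.zero_left {T : ℝ → ℝ → ℝ} (hT : IsTNorm T) {y : ℝ}
    (hy : y ∈ Icc (0 : ℝ) 1) : T 0 y = 0 := by
  have h0 : (0 : ℝ) ∈ Icc (0 : ℝ) 1 := by simp
  refine le_antisymm ?_ (hT.1 0 h0 y hy).1
  rw [hT.2.1 0 h0 y hy]
  exact hT.apply_le_right hy h0

theorem IsTNorm.apply_IY {T : ℝ → ℝ → ℝ} (hT : IsTNorm T) {x y : ℝ}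
    (hy : y ∈ Icc (0 : ℝ) 1) : T x (IY x y) = T x y := by
  unfold IY
  split_ifs with h
  · rcases h with rfl | rfl
    · rw [hT.zero_left hy, hT.zero_left (by simp)]
    · rfl
  · rfl

/-- I_Y is a fuzzy implication function and, for every t-norm T,
T(x, I_Y(x,y)) = T(x,y) on [0,1]²; consequently I_Y satisfies (TC) and (MTC)
with respect to every t-norm T. -/
theorem stmt_12 :
    IsFuzzyImplication IY ∧
    ∀ T : ℝ → ℝ → ℝ, IsTNorm T →
      (∀ x ∈ Icc (0:ℝ) 1, ∀ y ∈ Icc (0:ℝ) 1, T x (IY x y) = T x y) ∧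
      TCond T IY ∧ MTCond T IY := by
  refine ⟨isFuzzyImplication_IY, fun T hT => ⟨fun x _ y hy => hT.apply_IY hy, ?_, ?_⟩⟩
  · intro x hx y hy
    rw [hT.apply_IY hy]
    exact hT.apply_le_right hx hy
  · intro x' hx' x hx y hy h
    rw [hT.apply_IY hy, hT.apply_IY hy]
    exact hT.2.2.2.1 y hy x' hx' x hx h
end

section
/- Let T be a t-norm and I a fuzzy implication function satisfying the monotonicity of the generalized modus ponens (MTC) with respect to T. For a finite list l of elements of [0,1], let Fold_T(l) denote the iterated application of T defined by Fold_T([]) = 1 and Fold_T(a :: l) = T(a, Fold_T(l)). Then for all finite lists l, l' of elements of [0,1] and every c ∈ [0,1], T(Fold_T(l ++ l'), I(Fold_T(l ++ l'), c)) ≤ T(Fold_T(l), I(Fold_T(l), c)). That is, the truth value of the evaluation of a fuzzy implicative rule via the generalized modus ponens is decreasing under refinements of the rule. -/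
open Set

/-- The iterated t-norm of elements of the unit interval lies in the unit interval. -/
theorem IsTNorm.foldr_mem_Icc {T : ℝ → ℝ → ℝ} (hT : IsTNorm T) {l : List ℝ}
    (hl : ∀ a ∈ l, a ∈ Icc (0:ℝ) 1) : List.foldr T 1 l ∈ Icc (0:ℝ) 1 := by
  induction l with
  | nil => simp
  | cons a l ih =>
    rw [List.forall_mem_cons] at hl
    exact hT.1 a hl.1 _ (ih hl.2)

/-- Appending further elements decreases the iterated t-norm. -/
theorem IsTNorm.foldr_append_le {T : ℝ → ℝ → ℝ} (hT : IsTNorm T) {l l' : List ℝ}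
    (hl : ∀ a ∈ l, a ∈ Icc (0:ℝ) 1) (hl' : ∀ a ∈ l', a ∈ Icc (0:ℝ) 1) :
    List.foldr T 1 (l ++ l') ≤ List.foldr T 1 l := by
  induction l with
  | nil => exact (hT.foldr_mem_Icc hl').2
  | cons a l ih =>
    rw [List.forall_mem_cons] at hl
    have hmem := hT.foldr_mem_Icc (List.forall_mem_append.2 ⟨hl.2, hl'⟩)
    obtain ⟨-, -, -, -, hmono, -⟩ := id hT
    exact hmono a hl.1 _ hmem _ (hT.foldr_mem_Icc hl.2) (ih hl.2)

/-- if I satisfies (MTC) w.r.t. T, then the evaluation of a fuzzy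
implicative rule via the generalized modus ponens is decreasing under refinements:
with Fold_T = List.foldr T 1, for all lists l, l' of elements of [0,1] and c ∈ [0,1],
T(Fold_T(l ++ l'), I(Fold_T(l ++ l'), c)) ≤ T(Fold_T(l), I(Fold_T(l), c)). -/
theorem stmt_16 (T I : ℝ → ℝ → ℝ) (hT : IsTNorm T) (hI : IsFuzzyImplication I)
    (hMTC : MTCond T I) :
    ∀ l l' : List ℝ, (∀ a ∈ l, a ∈ Icc (0:ℝ) 1) → (∀ a ∈ l', a ∈ Icc (0:ℝ) 1) →
      ∀ c ∈ Icc (0:ℝ) 1,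
        T (List.foldr T 1 (l ++ l')) (I (List.foldr T 1 (l ++ l')) c) ≤
          T (List.foldr T 1 l) (I (List.foldr T 1 l) c) := by
  intro l l' hl hl' c hc
  exact hMTC _ (hT.foldr_mem_Icc (List.forall_mem_append.2 ⟨hl, hl'⟩)) _ (hT.foldr_mem_Icc hl)
    c hc (hT.foldr_append_le hl hl')
end
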